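/- For every n ≥ 3, there is no cyclic sequence c : Z/nZ → ℤ in which every three cyclically consecutive values are pairwise distinct and such that for every i ∈ Z/nZ the value c_{i+2} lies strictly between c_i and c_{i+1} (i.e., min(c_i, c_{i+1}) < c_{i+2} < max(c_i, c_{i+1})). Equivalently, the all-ones word 1^n is an illegal codeword in the (1,3,n)-LRM scheme. -/

import Mathlib

/-- A cyclic charge sequence `c : ZMod n → ℤ` has pairwise distinct values in every
window of three cyclically consecutive cells. -/
def DistinctWindows3 (n : ℕ) (c : ZMod n → ℤ) : Prop :=
  ∀ i : ZMod n, ∀ k l : Fin 3, k ≠ l →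
    c (i + ((k : ℕ) : ZMod n)) ≠ c (i + ((l : ℕ) : ZMod n))

/-- There is no cyclic charge sequence (with pairwise distinct values in every window
of three cyclically consecutive cells) in which every charge level lies strictly
between the two preceding ones; equivalently, the all-ones word `1^n` is an illegal
codeword in the `(1,3,n)`-LRM scheme. -/
theorem no_always_between (n : ℕ) (hn : 3 ≤ n) :
    ¬ ∃ c : ZMod n → ℤ, DistinctWindows3 n c ∧
      ∀ i : ZMod n,
        min (c i) (c (i + 1)) < c (i + 2) ∧ c (i + 2) < max (c i) (c (i + 1)) := by
  rintro ⟨c, -, h⟩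
  haveI : NeZero n := ⟨by omega⟩
  obtain ⟨m, hm⟩ := Finite.exists_max c
  have h1 := (h (m - 2)).2
  rw [sub_add_cancel] at h1
  exact absurd h1 (not_lt.mpr (max_le (hm _) (hm _)))
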